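/- arXiv:1212.1691 — 2 statements merged into one kernel-verified Lean document; each statement's English description precedes it below -/
import Mathlib

section
/- Suppose that for every admissible real-valued function f on [0,∞) that has compact support and satisfies τ_q f := −f'' + q f ∈ L²(0,∞), one has ∫₀^∞ (−f''(x) + q(x)f(x)) f(x) dx ≥ ∫₀^∞ |f(x)|² dx. Then the only admissible u ∈ L²(0,∞) satisfying −u'' + q u = 0 almost everywhere on (0,∞)∖X is u ≡ 0. (This triviality of the kernel is the core of the Glazman–Povzner–Wienholtz theorem for Hamiltonians with δ'-interactions: a lower semibounded minimal operator H_{X,β,q} is self-adjoint.) -/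
open MeasureTheory Set Filter

/-- An *admissible* function for the Hamiltonian with δ'-interactions on
`X = {x 1 < x 2 < ⋯}` (with `x 0 = 0`): `f` and `f'` are absolutely continuous on
each interval `(x k, x (k+1))`, with one-sided limits `fr k = f(x k +)`,
`fl k = f(x k −)`, `dr k = f'(x k +)`, `dl k = f'(x k −)`; `f'(0) = 0`; and at each
interior node `x (k+1)` the δ'-interface conditions
`f'(x_k+) = f'(x_k−)` and `f(x_k+) − f(x_k−) = β_k f'(x_k+)` hold.
Here `f''` is the a.e. derivative of the absolutely continuous function `f'`. -/
structure Admissible (x : ℕ → ℝ) (β : ℕ → ℝ) where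
  f : ℝ → ℝ
  f' : ℝ → ℝ
  f'' : ℝ → ℝ
  fr : ℕ → ℝ
  fl : ℕ → ℝ
  dr : ℕ → ℝ
  dl : ℕ → ℝ
  int_d : ∀ k, IntegrableOn f' (Icc (x k) (x (k + 1))) volume
  int_dd : ∀ k, IntegrableOn f'' (Icc (x k) (x (k + 1))) volume
  ftc : ∀ k, ∀ t ∈ Ioo (x k) (x (k + 1)), f t = fr k + ∫ s in Ioc (x k) t, f' s
  ftc_d : ∀ k, ∀ t ∈ Ioo (x k) (x (k + 1)), f' t = dr k + ∫ s in Ioc (x k) t, f'' s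
  fl_eq : ∀ k, fl (k + 1) = fr k + ∫ s in Ioc (x k) (x (k + 1)), f' s
  dl_eq : ∀ k, dl (k + 1) = dr k + ∫ s in Ioc (x k) (x (k + 1)), f'' s
  neumann : dr 0 = 0
  iface_deriv : ∀ k, dr (k + 1) = dl (k + 1)
  iface_jump : ∀ k, fr (k + 1) - fl (k + 1) = β (k + 1) * dr (k + 1)

section AbsolutelyContinuous

/-- `F` is absolutely continuous on the interval with endpoints `a`, `b`, with a.e. derivative
`g`. -/
def HasAEDeriv (F g : ℝ → ℝ) (a b : ℝ) : Prop :=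
  AbsolutelyContinuousOnInterval F a b ∧ ∀ᵐ t, t ∈ uIcc a b → HasDerivAt F (g t) t

variable {F G g h : ℝ → ℝ} {a b : ℝ}

theorem HasAEDeriv.mul (hF : HasAEDeriv F g a b) (hG : HasAEDeriv G h a b) :
    HasAEDeriv (fun t => F t * G t) (fun t => g t * G t + F t * h t) a b := by
  refine ⟨hF.1.fun_mul hG.1, ?_⟩
  filter_upwards [hF.2, hG.2] with t h1 h2 ht using (h1 ht).mul (h2 ht)

theorem HasAEDeriv.add (hF : HasAEDeriv F g a b) (hG : HasAEDeriv G h a b) :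
    HasAEDeriv (fun t => F t + G t) (fun t => g t + h t) a b := by
  refine ⟨hF.1.fun_add hG.1, ?_⟩
  filter_upwards [hF.2, hG.2] with t h1 h2 ht using (h1 ht).add (h2 ht)

theorem HasAEDeriv.congr_deriv (hF : HasAEDeriv F g a b)
    (hgh : ∀ᵐ t, t ∈ uIcc a b → g t = h t) : HasAEDeriv F h a b := by
  refine ⟨hF.1, ?_⟩
  filter_upwards [hF.2, hgh] with t h1 h2 ht using h2 ht ▸ h1 ht

theorem HasAEDeriv.mono {c d : ℝ} (hF : HasAEDeriv F g a b) (hsub : uIcc c d ⊆ uIcc a b) :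
    HasAEDeriv F g c d := by
  refine ⟨hF.1.mono hsub, ?_⟩
  filter_upwards [hF.2] with t h1 ht using h1 (hsub ht)

theorem HasAEDeriv.intervalIntegrable (hF : HasAEDeriv F g a b) :
    IntervalIntegrable g volume a b := by
  refine hF.1.intervalIntegrable_deriv.congr_ae ?_
  rw [EventuallyEq, ae_restrict_iff' measurableSet_uIoc]
  filter_upwards [hF.2] with t h1 ht using (h1 (uIoc_subset_uIcc ht)).deriv

theorem HasAEDeriv.integral_eq_sub (hF : HasAEDeriv F g a b) :
    ∫ t in a..b, g t = F b - F a := by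
  rw [← hF.1.integral_deriv_eq_sub]
  refine intervalIntegral.integral_congr_ae ?_
  filter_upwards [hF.2] with t h1 ht using (h1 (uIoc_subset_uIcc ht)).deriv.symm

theorem hasAEDeriv_const_add_integral (c : ℝ) (hg : IntervalIntegrable g volume a b) :
    HasAEDeriv (fun t => c + ∫ s in a..t, g s) g a b := by
  constructor
  · refine AbsolutelyContinuousOnInterval.fun_add ?_
      (hg.absolutelyContinuousOnInterval_intervalIntegral left_mem_uIcc)
    exact (contDiff_const (n := 1)).contDiffOn.absolutelyContinuousOnInterval
  · filter_upwards [hg.ae_hasDerivAt_integral] with t h1 ht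
    exact (h1 ht a left_mem_uIcc).const_add c

theorem hasAEDeriv_of_hasDerivAt (hF : ∀ t, HasDerivAt F (g t) t) (hg : Continuous g) :
    HasAEDeriv F g a b := by
  refine ⟨ContDiffOn.absolutelyContinuousOnInterval (ContDiff.contDiffOn ?_),
    ae_of_all _ fun t _ => hF t⟩
  rw [contDiff_one_iff_deriv]
  exact ⟨fun t => (hF t).differentiableAt, by rwa [funext fun t => (hF t).deriv]⟩

theorem ae_restrict_Ioc_of_Ioo (hgh : ∀ᵐ t, t ∈ Ioo a b → g t = h t) :
    g =ᵐ[volume.restrict (Ioc a b)] h := by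
  rw [← restrict_Ioo_eq_restrict_Ioc, EventuallyEq, ae_restrict_iff' measurableSet_Ioo]
  exact hgh

theorem intervalIntegrable_congr_Ioo (hab : a ≤ b) (hgh : ∀ᵐ t, t ∈ Ioo a b → g t = h t)
    (hh : IntervalIntegrable h volume a b) : IntervalIntegrable g volume a b := by
  refine hh.congr_ae ?_
  rw [uIoc_of_le hab]
  exact (ae_restrict_Ioc_of_Ioo hgh).symm

theorem integral_congr_Ioo (hab : a ≤ b) (hgh : ∀ᵐ t, t ∈ Ioo a b → g t = h t) :
    ∫ t in a..b, g t = ∫ t in a..b, h t := by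
  rw [intervalIntegral.integral_of_le hab, intervalIntegral.integral_of_le hab]
  exact integral_congr_ae (ae_restrict_Ioc_of_Ioo hgh)

end AbsolutelyContinuous

section Cutoff

/-- The cubic on `[a, b]` going from `c` to `d` with vanishing derivative at both ends. -/
noncomputable def smoothStep (a b c d t : ℝ) : ℝ :=
  c + (d - c) * (3 * ((t - a) / (b - a)) ^ 2 - 2 * ((t - a) / (b - a)) ^ 3)

/-- The derivative of `smoothStep`. -/
noncomputable def smoothStepDeriv (a b c d t : ℝ) : ℝ :=
  6 * ((d - c) / (b - a)) * (((t - a) / (b - a)) * (1 - (t - a) / (b - a)))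

/-- The second derivative of `smoothStep`. -/
noncomputable def smoothStepDeriv2 (a b c d t : ℝ) : ℝ :=
  6 * ((d - c) / (b - a)) * ((1 - 2 * ((t - a) / (b - a))) / (b - a))

variable {a b c d : ℝ}

theorem continuous_smoothStep : Continuous (smoothStep a b c d) := by
  unfold smoothStep; fun_prop

theorem continuous_smoothStepDeriv : Continuous (smoothStepDeriv a b c d) := by
  unfold smoothStepDeriv; fun_prop

theorem continuous_smoothStepDeriv2 : Continuous (smoothStepDeriv2 a b c d) := by
  unfold smoothStepDeriv2; fun_prop

theorem hasDerivAt_smoothStep (t : ℝ) :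
    HasDerivAt (smoothStep a b c d) (smoothStepDeriv a b c d t) t := by
  have hs : HasDerivAt (fun t => (t - a) / (b - a)) (1 / (b - a)) t :=
    ((hasDerivAt_id t).sub_const a).div_const _
  refine ((((hs.pow 2).const_mul 3).sub ((hs.pow 3).const_mul 2)).const_mul (d - c)
    |>.const_add c).congr_deriv ?_
  simp only [smoothStepDeriv]
  push_cast
  ring

theorem hasDerivAt_smoothStepDeriv (t : ℝ) :
    HasDerivAt (smoothStepDeriv a b c d) (smoothStepDeriv2 a b c d t) t := by
  have hs : HasDerivAt (fun t => (t - a) / (b - a)) (1 / (b - a)) t :=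
    ((hasDerivAt_id t).sub_const a).div_const _
  refine ((hs.mul (hs.const_sub 1)).const_mul (6 * ((d - c) / (b - a)))).congr_deriv ?_
  simp only [smoothStepDeriv2]
  ring

theorem smoothStep_left : smoothStep a b c d a = c := by simp [smoothStep]

theorem smoothStep_right (hab : a < b) : smoothStep a b c d b = d := by
  have : b - a ≠ 0 := by linarith
  simp only [smoothStep, div_self this]
  ring

theorem smoothStepDeriv_left : smoothStepDeriv a b c d a = 0 := by simp [smoothStepDeriv]

theorem smoothStepDeriv_right (hab : a < b) : smoothStepDeriv a b c d b = 0 := by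
  have : b - a ≠ 0 := by linarith
  simp [smoothStepDeriv, div_self this]

theorem smoothStep_self (t : ℝ) : smoothStep a b c c t = c := by simp [smoothStep]

theorem smoothStepDeriv_self (t : ℝ) : smoothStepDeriv a b c c t = 0 := by simp [smoothStepDeriv]

theorem smoothStepDeriv2_self (t : ℝ) : smoothStepDeriv2 a b c c t = 0 := by
  simp [smoothStepDeriv2]

theorem smoothStepDeriv_sq_le {L t : ℝ} (hab : a < b) (hL : |d - c| ≤ L * (b - a))
    (ht : t ∈ Icc a b) : smoothStepDeriv a b c d t ^ 2 ≤ 9 / 4 * L ^ 2 := by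
  have hba : 0 < b - a := by linarith
  have hr : |(d - c) / (b - a)| ≤ L := by
    rw [abs_div, abs_of_pos hba, div_le_iff₀ hba]; exact hL
  have hs0 : 0 ≤ (t - a) / (b - a) := div_nonneg (by linarith [ht.1]) hba.le
  have hs1 : (t - a) / (b - a) ≤ 1 := by rw [div_le_one hba]; linarith [ht.2]
  unfold smoothStepDeriv
  generalize (t - a) / (b - a) = s at *
  generalize (d - c) / (b - a) = r at *
  have h1 : r ^ 2 ≤ L ^ 2 := sq_le_sq' (by linarith [neg_abs_le r]) (by linarith [le_abs_self r])
  have h2 : 0 ≤ s * (1 - s) := mul_nonneg hs0 (by linarith)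
  have h3 : s * (1 - s) ≤ 1 / 4 := by nlinarith [sq_nonneg (s - 1 / 2)]
  have h4 : (s * (1 - s)) ^ 2 ≤ 1 / 16 := by nlinarith
  calc (6 * r * (s * (1 - s))) ^ 2 = 36 * (r ^ 2 * (s * (1 - s)) ^ 2) := by ring
    _ ≤ 36 * (L ^ 2 * (1 / 16)) := by gcongr
    _ = 9 / 4 * L ^ 2 := by ring

/-- The piecewise linear function equal to `1` up to `N` and to `0` from `2 * N` on. -/
noncomputable def linearCutoff (N t : ℝ) : ℝ := max 0 (min 1 (2 - t / N))

theorem abs_linearCutoff_sub_le {N s t : ℝ} (hN : 0 < N) (hst : s ≤ t) :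
    |linearCutoff N t - linearCutoff N s| ≤ 1 / N * (t - s) := by
  have h1 : s / N ≤ t / N := by gcongr
  have h2 : 1 / N * (t - s) = t / N - s / N := by ring
  rw [h2, abs_le]
  unfold linearCutoff
  constructor <;> grind

theorem linearCutoff_eq_one {N t : ℝ} (hN : 0 < N) (ht : t ≤ N) : linearCutoff N t = 1 := by
  have : t / N ≤ 1 := (div_le_one hN).2 ht
  unfold linearCutoff
  grind

theorem linearCutoff_eq_zero {N t : ℝ} (hN : 0 < N) (ht : 2 * N ≤ t) : linearCutoff N t = 0 := by
  have : 2 ≤ t / N := (le_div_iff₀ hN).2 ht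
  unfold linearCutoff
  grind

end Cutoff

section Nodes

/-- For `t ∈ [x k, x (k + 1))` with `x` strictly increasing, this is `k`. -/
noncomputable def nodeIndex (x : ℕ → ℝ) (t : ℝ) : ℕ := sInf {k | t < x (k + 1)}

variable {x : ℕ → ℝ} {t : ℝ}

theorem nodeIndex_eq (hmono : StrictMono x) {k : ℕ} (ht : t ∈ Ioo (x k) (x (k + 1))) :
    nodeIndex x t = k := by
  refine le_antisymm (Nat.sInf_le ht.2) ?_
  refine le_csInf ⟨k, ht.2⟩ fun j (hj : t < x (j + 1)) => ?_
  exact Nat.lt_succ_iff.1 (hmono.lt_iff_lt.1 (ht.1.trans hj))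

theorem le_nodeIndex (hmono : StrictMono x) (hxtop : Tendsto x atTop atTop) {K : ℕ}
    (ht : x K ≤ t) : K ≤ nodeIndex x t := by
  obtain ⟨n, hn⟩ := (hxtop.eventually_gt_atTop t).exists
  have hn' : t < x (n + 1) := hn.trans (hmono n.lt_succ_self)
  refine le_csInf ⟨n, hn'⟩ fun j (hj : t < x (j + 1)) => ?_
  exact Nat.lt_succ_iff.1 (hmono.lt_iff_lt.1 (ht.trans_lt hj))

theorem integrableOn_Ioi_of_pieces (hmono : StrictMono x) {G : ℝ → ℝ} {K : ℕ}
    (hG : ∀ k, IntervalIntegrable G volume (x k) (x (k + 1))) (hzero : ∀ t, x K ≤ t → G t = 0) :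
    IntegrableOn G (Ioi (x 0)) := by
  have h := (IntervalIntegrable.trans_iterate (n := K) fun k _ => hG k).1
  rw [← Ioc_union_Ioi_eq_Ioi (hmono.monotone K.zero_le)]
  refine h.union ((integrableOn_zero (ε' := ℝ)).congr_fun (fun t ht => ?_) measurableSet_Ioi)
  exact (hzero t (le_of_lt ht)).symm

theorem integral_Ioi_eq_sum_pieces (hmono : StrictMono x) {G : ℝ → ℝ} {K : ℕ}
    (hG : ∀ k, IntervalIntegrable G volume (x k) (x (k + 1))) (hzero : ∀ t, x K ≤ t → G t = 0) :
    ∫ t in Ioi (x 0), G t = ∑ k ∈ Finset.range K, ∫ t in x k..x (k + 1), G t := by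
  rw [intervalIntegral.sum_integral_adjacent_intervals fun k _ => hG k,
    intervalIntegral.integral_of_le (hmono.monotone K.zero_le)]
  refine setIntegral_eq_of_subset_of_forall_sdiff_eq_zero measurableSet_Ioi Ioc_subset_Ioi_self ?_
  intro t ht
  refine hzero t (le_of_lt (not_le.1 fun hle => ht.2 ⟨ht.1, hle⟩))

end Nodes

namespace Admissible

variable {x β : ℕ → ℝ} (u : Admissible x β)

/-- The continuous extension of `u.f` from `(x k, x (k + 1))` to the closed interval. -/
noncomputable def ext (k : ℕ) (t : ℝ) : ℝ := u.fr k + ∫ s in x k..t, u.f' s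

/-- The continuous extension of `u.f'` from `(x k, x (k + 1))` to the closed interval. -/
noncomputable def extDeriv (k : ℕ) (t : ℝ) : ℝ := u.dr k + ∫ s in x k..t, u.f'' s

variable {u} {k : ℕ} {t : ℝ}

theorem f_eq_ext (ht : t ∈ Ioo (x k) (x (k + 1))) : u.f t = u.ext k t := by
  rw [u.ftc k t ht, ext, intervalIntegral.integral_of_le ht.1.le]

theorem deriv_eq_extDeriv (ht : t ∈ Ioo (x k) (x (k + 1))) : u.f' t = u.extDeriv k t := by
  rw [u.ftc_d k t ht, extDeriv, intervalIntegral.integral_of_le ht.1.le]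

variable (u)

theorem ext_left (k : ℕ) : u.ext k (x k) = u.fr k := by simp [ext]

theorem extDeriv_left (k : ℕ) : u.extDeriv k (x k) = u.dr k := by simp [extDeriv]

theorem ext_right (hmono : StrictMono x) (k : ℕ) : u.ext k (x (k + 1)) = u.fl (k + 1) := by
  rw [u.fl_eq, ext, intervalIntegral.integral_of_le (hmono k.lt_succ_self).le]

theorem extDeriv_right (hmono : StrictMono x) (k : ℕ) :
    u.extDeriv k (x (k + 1)) = u.dl (k + 1) := by
  rw [u.dl_eq, extDeriv, intervalIntegral.integral_of_le (hmono k.lt_succ_self).le]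

theorem hasAEDeriv_extDeriv (hmono : StrictMono x) (k : ℕ) :
    HasAEDeriv (u.extDeriv k) u.f'' (x k) (x (k + 1)) := by
  refine hasAEDeriv_const_add_integral _ ?_
  rw [intervalIntegrable_iff_integrableOn_Icc_of_le (hmono k.lt_succ_self).le]
  exact u.int_dd k

theorem hasAEDeriv_ext (hmono : StrictMono x) (k : ℕ) :
    HasAEDeriv (u.ext k) (u.extDeriv k) (x k) (x (k + 1)) := by
  have hle := (hmono k.lt_succ_self).le
  refine HasAEDeriv.congr_deriv (g := u.f') (hasAEDeriv_const_add_integral _ ?_) ?_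
  · rw [intervalIntegrable_iff_integrableOn_Icc_of_le hle]
    exact u.int_d k
  · rw [uIcc_of_le hle, ← ae_restrict_iff' measurableSet_Icc, ← restrict_Ioo_eq_restrict_Icc,
      ae_restrict_iff' measurableSet_Ioo]
    exact ae_of_all _ fun t ht => deriv_eq_extDeriv ht

theorem continuousOn_ext (hmono : StrictMono x) (k : ℕ) :
    ContinuousOn (u.ext k) (uIcc (x k) (x (k + 1))) :=
  (u.hasAEDeriv_ext hmono k).1.continuousOn

theorem continuousOn_extDeriv (hmono : StrictMono x) (k : ℕ) :
    ContinuousOn (u.extDeriv k) (uIcc (x k) (x (k + 1))) :=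
  (u.hasAEDeriv_extDeriv hmono k).1.continuousOn

/-- Multiplication of an admissible function by a piecewise cubic taking the value `c k` at `x k`
with vanishing derivative there. -/
noncomputable def cutoff (hmono : StrictMono x) (c : ℕ → ℝ) : Admissible x β := by
  let P : ℕ → ℝ → ℝ := fun k => smoothStep (x k) (x (k + 1)) (c k) (c (k + 1))
  let P₁ : ℕ → ℝ → ℝ := fun k => smoothStepDeriv (x k) (x (k + 1)) (c k) (c (k + 1))
  let P₂ : ℕ → ℝ → ℝ := fun k => smoothStepDeriv2 (x k) (x (k + 1)) (c k) (c (k + 1))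
  have hlt : ∀ k, x k < x (k + 1) := fun k => hmono k.lt_succ_self
  have hP : ∀ k, HasAEDeriv (P k) (P₁ k) (x k) (x (k + 1)) := fun k =>
    hasAEDeriv_of_hasDerivAt hasDerivAt_smoothStep continuous_smoothStepDeriv
  have hP₁ : ∀ k, HasAEDeriv (P₁ k) (P₂ k) (x k) (x (k + 1)) := fun k =>
    hasAEDeriv_of_hasDerivAt hasDerivAt_smoothStepDeriv continuous_smoothStepDeriv2
  let f : ℝ → ℝ := fun t => P (nodeIndex x t) t * u.f t
  let f₁ : ℝ → ℝ := fun t => P₁ (nodeIndex x t) t * u.f t + P (nodeIndex x t) t * u.f' t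
  let f₂ : ℝ → ℝ := fun t => P₂ (nodeIndex x t) t * u.f t + 2 * (P₁ (nodeIndex x t) t * u.f' t)
    + P (nodeIndex x t) t * u.f'' t
  have hf : ∀ k, HasAEDeriv (fun t => P k t * u.ext k t)
      (fun t => P₁ k t * u.ext k t + P k t * u.extDeriv k t) (x k) (x (k + 1)) :=
    fun k => (hP k).mul (u.hasAEDeriv_ext hmono k)
  have hf₁ : ∀ k, HasAEDeriv (fun t => P₁ k t * u.ext k t + P k t * u.extDeriv k t)
      (fun t => (P₂ k t * u.ext k t + P₁ k t * u.extDeriv k t) +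
        (P₁ k t * u.extDeriv k t + P k t * u.f'' t)) (x k) (x (k + 1)) :=
    fun k => ((hP₁ k).mul (u.hasAEDeriv_ext hmono k)).add
      ((hP k).mul (u.hasAEDeriv_extDeriv hmono k))
  have ef : ∀ k, ∀ t ∈ Ioo (x k) (x (k + 1)), f t = P k t * u.ext k t := fun k t ht => by
    simp only [f, nodeIndex_eq hmono ht, f_eq_ext ht]
  have ef₁ : ∀ k, ∀ t ∈ Ioo (x k) (x (k + 1)),
      f₁ t = P₁ k t * u.ext k t + P k t * u.extDeriv k t := fun k t ht => by
    simp only [f₁, nodeIndex_eq hmono ht, f_eq_ext ht, deriv_eq_extDeriv ht]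
  have ef₂ : ∀ k, ∀ t ∈ Ioo (x k) (x (k + 1)),
      f₂ t = (P₂ k t * u.ext k t + P₁ k t * u.extDeriv k t) +
        (P₁ k t * u.extDeriv k t + P k t * u.f'' t) := fun k t ht => by
    simp only [f₂, nodeIndex_eq hmono ht, f_eq_ext ht, deriv_eq_extDeriv ht]
    ring
  have if₁ : ∀ k, ∀ t ∈ Ioc (x k) (x (k + 1)),
      ∫ s in Ioc (x k) t, f₁ s = P k t * u.ext k t - P k (x k) * u.ext k (x k) := by
    intro k t ht
    rw [← intervalIntegral.integral_of_le ht.1.le, integral_congr_Ioo ht.1.le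
      (ae_of_all _ fun s hs => ef₁ k s (Ioo_subset_Ioo_right ht.2 hs))]
    refine ((hf k).mono ?_).integral_eq_sub
    rw [uIcc_of_le ht.1.le, uIcc_of_le (hlt k).le]
    exact Icc_subset_Icc_right ht.2
  have if₂ : ∀ k, ∀ t ∈ Ioc (x k) (x (k + 1)),
      ∫ s in Ioc (x k) t, f₂ s = (P₁ k t * u.ext k t + P k t * u.extDeriv k t) -
        (P₁ k (x k) * u.ext k (x k) + P k (x k) * u.extDeriv k (x k)) := by
    intro k t ht
    rw [← intervalIntegral.integral_of_le ht.1.le, integral_congr_Ioo ht.1.le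
      (ae_of_all _ fun s hs => ef₂ k s (Ioo_subset_Ioo_right ht.2 hs))]
    refine ((hf₁ k).mono ?_).integral_eq_sub
    rw [uIcc_of_le ht.1.le, uIcc_of_le (hlt k).le]
    exact Icc_subset_Icc_right ht.2
  have Pl : ∀ k, P k (x k) = c k := fun k => smoothStep_left
  have Pr : ∀ k, P k (x (k + 1)) = c (k + 1) := fun k => smoothStep_right (hlt k)
  have P₁l : ∀ k, P₁ k (x k) = 0 := fun k => smoothStepDeriv_left
  have P₁r : ∀ k, P₁ k (x (k + 1)) = 0 := fun k => smoothStepDeriv_right (hlt k)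
  exact
  { f := f
    f' := f₁
    f'' := f₂
    fr := fun k => c k * u.fr k
    fl := fun k => c k * u.fl k
    dr := fun k => c k * u.dr k
    dl := fun k => c k * u.dl k
    int_d := fun k => by
      rw [← intervalIntegrable_iff_integrableOn_Icc_of_le (hlt k).le]
      exact intervalIntegrable_congr_Ioo (hlt k).le (ae_of_all _ (ef₁ k)) (hf k).intervalIntegrable
    int_dd := fun k => by
      rw [← intervalIntegrable_iff_integrableOn_Icc_of_le (hlt k).le]
      exact intervalIntegrable_congr_Ioo (hlt k).le (ae_of_all _ (ef₂ k))
        (hf₁ k).intervalIntegrable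
    ftc := fun k t ht => by
      rw [if₁ k t (Ioo_subset_Ioc_self ht), ef k t ht, Pl, ext_left]
      ring
    ftc_d := fun k t ht => by
      rw [if₂ k t (Ioo_subset_Ioc_self ht), ef₁ k t ht, Pl, P₁l, extDeriv_left]
      ring
    fl_eq := fun k => by
      rw [if₁ k _ (right_mem_Ioc.2 (hlt k)), Pl, Pr, ext_left, ext_right u hmono]
      ring
    dl_eq := fun k => by
      rw [if₂ k _ (right_mem_Ioc.2 (hlt k)), Pl, Pr, P₁l, P₁r, extDeriv_left,
        extDeriv_right u hmono]
      ring
    neumann := by rw [u.neumann, mul_zero]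
    iface_deriv := fun k => by rw [u.iface_deriv]
    iface_jump := fun k => by rw [← mul_sub, u.iface_jump]; ring }

section Energy

variable (hmono : StrictMono x) (c : ℕ → ℝ)

theorem cutoff_f (t : ℝ) : (u.cutoff hmono c).f t =
    smoothStep (x (nodeIndex x t)) (x (nodeIndex x t + 1)) (c (nodeIndex x t))
      (c (nodeIndex x t + 1)) t * u.f t := rfl

theorem cutoff_deriv2 (t : ℝ) : (u.cutoff hmono c).f'' t =
    smoothStepDeriv2 (x (nodeIndex x t)) (x (nodeIndex x t + 1)) (c (nodeIndex x t))
        (c (nodeIndex x t + 1)) t * u.f t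
      + 2 * (smoothStepDeriv (x (nodeIndex x t)) (x (nodeIndex x t + 1)) (c (nodeIndex x t))
        (c (nodeIndex x t + 1)) t * u.f' t)
      + smoothStep (x (nodeIndex x t)) (x (nodeIndex x t + 1)) (c (nodeIndex x t))
        (c (nodeIndex x t + 1)) t * u.f'' t := rfl

variable {q : ℝ → ℝ} {c}

theorem cutoff_eq_zero (hxtop : Tendsto x atTop atTop) {K : ℕ} (hc : ∀ k, K ≤ k → c k = 0)
    (ht : x K ≤ t) : (u.cutoff hmono c).f t = 0 ∧ (u.cutoff hmono c).f'' t = 0 := by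
  have hK := le_nodeIndex hmono hxtop ht
  rw [cutoff_f, cutoff_deriv2, hc _ hK, hc _ (hK.trans (Nat.le_succ _))]
  simp [smoothStep_self, smoothStepDeriv_self, smoothStepDeriv2_self]

variable (c)

theorem cutoff_f_eq (ht : t ∈ Ioo (x k) (x (k + 1))) : (u.cutoff hmono c).f t =
    smoothStep (x k) (x (k + 1)) (c k) (c (k + 1)) t * u.ext k t := by
  rw [cutoff_f, nodeIndex_eq hmono ht, f_eq_ext ht]

theorem cutoff_operator_ae (hx0 : x 0 = 0)
    (heq : ∀ᵐ t ∂(volume.restrict (Ioi (0 : ℝ))), -u.f'' t + q t * u.f t = 0) (k : ℕ) :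
    ∀ᵐ t, t ∈ Ioo (x k) (x (k + 1)) →
      -(u.cutoff hmono c).f'' t + q t * (u.cutoff hmono c).f t =
        -(smoothStepDeriv2 (x k) (x (k + 1)) (c k) (c (k + 1)) t * u.ext k t
          + 2 * (smoothStepDeriv (x k) (x (k + 1)) (c k) (c (k + 1)) t * u.extDeriv k t)) := by
  rw [ae_restrict_iff' measurableSet_Ioi] at heq
  filter_upwards [heq] with t h ht
  have h0 : 0 ≤ x k := hx0 ▸ hmono.monotone k.zero_le
  have h := h (h0.trans_lt ht.1)
  rw [cutoff_f, cutoff_deriv2, nodeIndex_eq hmono ht, ← f_eq_ext ht, ← deriv_eq_extDeriv ht]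
  linear_combination smoothStep (x k) (x (k + 1)) (c k) (c (k + 1)) t * h

theorem intervalIntegrable_cutoff_sq (k : ℕ) :
    IntervalIntegrable (fun t => (u.cutoff hmono c).f t ^ 2) volume (x k) (x (k + 1)) := by
  have hU := u.continuousOn_ext hmono k
  refine intervalIntegrable_congr_Ioo (hmono k.lt_succ_self).le
    (ae_of_all _ fun t ht => by rw [cutoff_f_eq u hmono c ht]) (ContinuousOn.intervalIntegrable ?_)
  exact (continuous_smoothStep.continuousOn.mul hU).pow 2

theorem intervalIntegrable_cutoff_operator_sq (hx0 : x 0 = 0)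
    (heq : ∀ᵐ t ∂(volume.restrict (Ioi (0 : ℝ))), -u.f'' t + q t * u.f t = 0) (k : ℕ) :
    IntervalIntegrable
      (fun t => (-(u.cutoff hmono c).f'' t + q t * (u.cutoff hmono c).f t) ^ 2)
      volume (x k) (x (k + 1)) := by
  have hU := u.continuousOn_ext hmono k
  have hV := u.continuousOn_extDeriv hmono k
  have hae := u.cutoff_operator_ae hmono c hx0 heq k
  refine intervalIntegrable_congr_Ioo (hmono k.lt_succ_self).le
    (hae.mono fun t h ht => by rw [h ht]) (ContinuousOn.intervalIntegrable ?_)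
  exact (((continuous_smoothStepDeriv2.continuousOn.mul hU).add
    (continuousOn_const.mul (continuous_smoothStepDeriv.continuousOn.mul hV))).neg).pow 2

theorem cutoff_energy (hx0 : x 0 = 0)
    (heq : ∀ᵐ t ∂(volume.restrict (Ioi (0 : ℝ))), -u.f'' t + q t * u.f t = 0) (k : ℕ) :
    IntervalIntegrable
      (fun t => (-(u.cutoff hmono c).f'' t + q t * (u.cutoff hmono c).f t) *
        (u.cutoff hmono c).f t) volume (x k) (x (k + 1)) ∧
    ∫ t in x k..x (k + 1), (-(u.cutoff hmono c).f'' t + q t * (u.cutoff hmono c).f t) *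
        (u.cutoff hmono c).f t =
      ∫ t in x k..x (k + 1),
        smoothStepDeriv (x k) (x (k + 1)) (c k) (c (k + 1)) t ^ 2 * u.ext k t ^ 2 := by
  have hlt := hmono k.lt_succ_self
  have hU := u.continuousOn_ext hmono k
  have hV := u.continuousOn_extDeriv hmono k
  have hae := u.cutoff_operator_ae hmono c hx0 heq k
  have hf : ∀ t ∈ Ioo (x k) (x (k + 1)), (u.cutoff hmono c).f t = _ :=
    fun t ht => cutoff_f_eq u hmono c ht
  have hP : HasAEDeriv (smoothStep (x k) (x (k + 1)) (c k) (c (k + 1))) _ (x k) (x (k + 1)) :=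
    hasAEDeriv_of_hasDerivAt hasDerivAt_smoothStep continuous_smoothStepDeriv
  have hP₁ : HasAEDeriv (smoothStepDeriv (x k) (x (k + 1)) (c k) (c (k + 1))) _
      (x k) (x (k + 1)) :=
    hasAEDeriv_of_hasDerivAt hasDerivAt_smoothStepDeriv continuous_smoothStepDeriv2
  have cP : ContinuousOn (smoothStep (x k) (x (k + 1)) (c k) (c (k + 1)))
    (uIcc (x k) (x (k + 1))) := continuous_smoothStep.continuousOn
  have cP₁ : ContinuousOn (smoothStepDeriv (x k) (x (k + 1)) (c k) (c (k + 1)))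
    (uIcc (x k) (x (k + 1))) := continuous_smoothStepDeriv.continuousOn
  have cP₂ : ContinuousOn (smoothStepDeriv2 (x k) (x (k + 1)) (c k) (c (k + 1)))
    (uIcc (x k) (x (k + 1))) := continuous_smoothStepDeriv2.continuousOn
  have P₁l : smoothStepDeriv (x k) (x (k + 1)) (c k) (c (k + 1)) (x k) = 0 := smoothStepDeriv_left
  have P₁r : smoothStepDeriv (x k) (x (k + 1)) (c k) (c (k + 1)) (x (k + 1)) = 0 :=
    smoothStepDeriv_right hlt
  have hUU := u.hasAEDeriv_ext hmono k
  generalize smoothStep (x k) (x (k + 1)) (c k) (c (k + 1)) = P at *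
  generalize smoothStepDeriv (x k) (x (k + 1)) (c k) (c (k + 1)) = P₁ at *
  generalize smoothStepDeriv2 (x k) (x (k + 1)) (c k) (c (k + 1)) = P₂ at *
  have hbdry := (hP.mul hP₁).mul (hUU.mul hUU)
  have hae' : ∀ᵐ t, t ∈ Ioo (x k) (x (k + 1)) →
      (-(u.cutoff hmono c).f'' t + q t * (u.cutoff hmono c).f t) * (u.cutoff hmono c).f t =
        P₁ t ^ 2 * u.ext k t ^ 2 -
          ((P₁ t * P₁ t + P t * P₂ t) * (u.ext k t * u.ext k t) +
            P t * P₁ t * (u.extDeriv k t * u.ext k t + u.ext k t * u.extDeriv k t)) := by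
    filter_upwards [hae] with t h ht
    rw [h ht, hf t ht]
    ring
  have hB : IntervalIntegrable (fun t => P₁ t ^ 2 * u.ext k t ^ 2) volume (x k) (x (k + 1)) :=
    ((cP₁.pow 2).mul (hU.pow 2)).intervalIntegrable
  refine ⟨intervalIntegrable_congr_Ioo hlt.le hae' (hB.sub hbdry.intervalIntegrable), ?_⟩
  rw [integral_congr_Ioo hlt.le hae', intervalIntegral.integral_sub hB hbdry.intervalIntegrable,
    hbdry.integral_eq_sub, P₁l, P₁r]
  ring

end Energy

theorem intervalIntegrable_sq (hmono : StrictMono x) (k : ℕ) :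
    IntervalIntegrable (fun t => u.f t ^ 2) volume (x k) (x (k + 1)) :=
  intervalIntegrable_congr_Ioo (hmono k.lt_succ_self).le
    (ae_of_all _ fun t ht => by rw [f_eq_ext ht, Pi.pow_apply])
    ((u.continuousOn_ext hmono k).pow 2).intervalIntegrable

theorem integral_sq_le (hx0 : x 0 = 0) (hmono : StrictMono x) (hxtop : Tendsto x atTop atTop)
    {q : ℝ → ℝ}
    (hsemibounded : ∀ F : Admissible x β, (∃ R, ∀ t, R ≤ t → F.f t = 0) →
      IntegrableOn (fun t => (-F.f'' t + q t * F.f t) ^ 2) (Ioi 0) volume →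
      (∫ t in Ioi (0 : ℝ), (-F.f'' t + q t * F.f t) * F.f t) ≥
        ∫ t in Ioi (0 : ℝ), F.f t ^ 2)
    (hu : IntegrableOn (fun t => u.f t ^ 2) (Ioi 0) volume)
    (heq : ∀ᵐ t ∂(volume.restrict (Ioi (0 : ℝ))), -u.f'' t + q t * u.f t = 0)
    {N : ℝ} (hN : 0 < N) (m : ℕ) (hm : x (m + 1) ≤ N) :
    ∫ t in x m..x (m + 1), u.f t ^ 2 ≤ 9 / 4 * (1 / N) ^ 2 * ∫ t in Ioi (0 : ℝ), u.f t ^ 2 := by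
  obtain ⟨K, hK⟩ := (hxtop.eventually_ge_atTop (2 * N)).exists
  have hlt : ∀ k, x k < x (k + 1) := fun k => hmono k.lt_succ_self
  let c : ℕ → ℝ := fun k => linearCutoff N (x k)
  have hc : ∀ k, K ≤ k → c k = 0 := fun k hk =>
    linearCutoff_eq_zero hN (hK.trans (hmono.monotone hk))
  let F := u.cutoff hmono c
  have hF0 : ∀ t, x K ≤ t → F.f t = 0 := fun t ht => (u.cutoff_eq_zero hmono hxtop hc ht).1
  have hF2 : ∀ t, x K ≤ t → F.f'' t = 0 := fun t ht => (u.cutoff_eq_zero hmono hxtop hc ht).2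
  have hmK : m < K := hmono.lt_iff_lt.1 (by linarith [hlt m])
  have key := hsemibounded F ⟨x K, hF0⟩ (by
    rw [← hx0]
    exact integrableOn_Ioi_of_pieces (K := K) hmono
      (u.intervalIntegrable_cutoff_operator_sq hmono c hx0 heq)
      fun t ht => by simp [hF0 t ht, hF2 t ht])
  rw [← hx0, integral_Ioi_eq_sum_pieces (K := K) hmono
      (fun k => (u.cutoff_energy hmono c hx0 heq k).1) fun t ht => by simp [F, hF0 t ht],
    integral_Ioi_eq_sum_pieces (K := K) hmono (u.intervalIntegrable_cutoff_sq hmono c)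
      fun t ht => by simp [F, hF0 t ht], ge_iff_le] at key
  calc ∫ t in x m..x (m + 1), u.f t ^ 2
      = ∫ t in x m..x (m + 1), F.f t ^ 2 := by
        refine integral_congr_Ioo (hlt m).le (ae_of_all _ fun t ht => ?_)
        have h1 : c m = 1 := linearCutoff_eq_one hN ((hlt m).le.trans hm)
        have h2 : c (m + 1) = 1 := linearCutoff_eq_one hN hm
        rw [cutoff_f_eq u hmono c ht, h1, h2, smoothStep_self, one_mul, f_eq_ext ht]
    _ ≤ ∑ k ∈ Finset.range K, ∫ t in x k..x (k + 1), F.f t ^ 2 :=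
        Finset.single_le_sum (f := fun k => ∫ t in x k..x (k + 1), F.f t ^ 2)
          (fun k _ => intervalIntegral.integral_nonneg (hlt k).le fun t _ => sq_nonneg _)
          (Finset.mem_range.2 hmK)
    _ ≤ _ := key
    _ ≤ ∑ k ∈ Finset.range K, 9 / 4 * (1 / N) ^ 2 * ∫ t in x k..x (k + 1), u.f t ^ 2 := by
        refine Finset.sum_le_sum fun k _ => ?_
        rw [(u.cutoff_energy hmono c hx0 heq k).2, ← intervalIntegral.integral_const_mul,
          integral_congr_Ioo (g := fun t => 9 / 4 * (1 / N) ^ 2 * u.f t ^ 2)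
            (h := fun t => 9 / 4 * (1 / N) ^ 2 * u.ext k t ^ 2) (hlt k).le
            (ae_of_all _ fun t ht => by simp only [f_eq_ext ht])]
        have hU := u.continuousOn_ext hmono k
        refine intervalIntegral.integral_mono_on (hlt k).le
          ((continuous_smoothStepDeriv.continuousOn.pow 2).mul (hU.pow 2)).intervalIntegrable
          (continuousOn_const.mul (hU.pow 2)).intervalIntegrable fun t ht => ?_
        gcongr
        exact smoothStepDeriv_sq_le (hlt k) (abs_linearCutoff_sub_le hN (hlt k).le) ht
    _ ≤ 9 / 4 * (1 / N) ^ 2 * ∫ t in Ioi (0 : ℝ), u.f t ^ 2 := by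
        rw [← Finset.mul_sum, intervalIntegral.sum_integral_adjacent_intervals
          fun k _ => u.intervalIntegrable_sq hmono k,
          intervalIntegral.integral_of_le (hmono.monotone K.zero_le), hx0]
        refine mul_le_mul_of_nonneg_left ?_ (by positivity)
        exact setIntegral_mono_set hu (ae_of_all _ fun t => sq_nonneg _)
          Ioc_subset_Ioi_self.eventuallyLE

end Admissible

/-- **Glazman–Povzner–Wienholtz for δ'-interactions** (core of Theorem 1.1 /
Theorem 2.1): if `∫₀^∞ (−f'' + q f) f ≥ ∫₀^∞ |f|²` for every compactly supported
admissible `f` with `τ_q f = −f'' + q f ∈ L²(0,∞)`, then the only admissible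
`u ∈ L²(0,∞)` with `−u'' + q u = 0` a.e. on `(0,∞)∖X` is `u ≡ 0`. -/
theorem stmt_2 (x : ℕ → ℝ) (hx0 : x 0 = 0) (hmono : StrictMono x)
    (hxtop : Tendsto x atTop atTop)
    (q : ℝ → ℝ) (hq : ∀ a b : ℝ, 0 ≤ a → IntegrableOn q (Icc a b) volume)
    (β : ℕ → ℝ) (hβ : ∀ k, β (k + 1) ≠ 0)
    (hsemibounded : ∀ F : Admissible x β, (∃ R, ∀ t, R ≤ t → F.f t = 0) →
      IntegrableOn (fun t => (-F.f'' t + q t * F.f t) ^ 2) (Ioi 0) volume →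
      (∫ t in Ioi (0 : ℝ), (-F.f'' t + q t * F.f t) * F.f t) ≥
        ∫ t in Ioi (0 : ℝ), F.f t ^ 2)
    (u : Admissible x β)
    (hu : IntegrableOn (fun t => u.f t ^ 2) (Ioi 0) volume)
    (heq : ∀ᵐ t ∂(volume.restrict (Ioi (0 : ℝ))), -u.f'' t + q t * u.f t = 0) :
    ∀ᵐ t ∂(volume.restrict (Ioi (0 : ℝ))), u.f t = 0 := by
  have hpiece : ∀ m, ∀ᵐ t ∂(volume.restrict (Ioc (x m) (x (m + 1)))), u.f t = 0 := by
    intro m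
    have hle := (hmono m.lt_succ_self).le
    have hlim : Tendsto (fun N : ℝ => 9 / 4 * (1 / N) ^ 2 * ∫ t in Ioi (0 : ℝ), u.f t ^ 2)
        atTop (nhds 0) := by
      have h : Tendsto (fun N : ℝ => 1 / N) atTop (nhds 0) := by
        simpa using tendsto_inv_atTop_zero (𝕜 := ℝ)
      simpa using ((h.pow 2).const_mul (9 / 4)).mul_const (∫ t in Ioi (0 : ℝ), u.f t ^ 2)
    have hnonpos : ∫ t in x m..x (m + 1), u.f t ^ 2 ≤ 0 := by
      refine ge_of_tendsto hlim ?_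
      filter_upwards [eventually_gt_atTop 0, eventually_ge_atTop (x (m + 1))] with N hN hm
      exact u.integral_sq_le hx0 hmono hxtop hsemibounded hu heq hN m hm
    have hzero : ∫ t in Ioc (x m) (x (m + 1)), u.f t ^ 2 = 0 := by
      rw [intervalIntegral.integral_of_le hle] at hnonpos
      exact le_antisymm hnonpos (integral_nonneg fun t => sq_nonneg _)
    rw [integral_eq_zero_iff_of_nonneg (fun t => sq_nonneg _)
      (u.intervalIntegrable_sq hmono m).1] at hzero
    filter_upwards [hzero] with t ht
    exact pow_eq_zero_iff two_ne_zero |>.1 ht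
  rw [← ae_restrict_iUnion_iff] at hpiece
  refine ae_restrict_of_ae_restrict_of_subset (fun t (ht : 0 < t) => ?_) hpiece
  have hex : ∃ k, t ≤ x (k + 1) :=
    ((hxtop.comp (tendsto_add_atTop_nat 1)).eventually_ge_atTop t).exists
  classical
  refine mem_iUnion.2 ⟨Nat.find hex, ?_, Nat.find_spec hex⟩
  rcases hk : Nat.find hex with _ | k
  · rwa [hx0]
  · exact not_le.1 (Nat.find_min hex (m := k) (by omega))
end

section
/- Assume d^* < ∞, q ∈ L¹_loc([0,∞)) real-valued, and lim_{k→∞} (1/d_k) ∫_{Δ_k} |q(x)| dx = 0. Then for every ε > 0 there exists N ∈ ℕ such that every piecewise H¹ function f with Σ_k ∫_{Δ_k}(|f'(x)|² + |f(x)|²) dx ≤ 1 satisfies ∫_{x_N}^∞ |q(x)| |f(x)|² dx ≤ ε. (This uniform tail estimate is the core of the compactness of the embedding W^{1,2}(ℝ₊∖X) → L²(ℝ₊; |q|) in Lemma 4.2.) -/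
open MeasureTheory Set Filter

noncomputable section

/-- A function that is *piecewise `H¹`* with respect to the partition points
`x 0 < x 1 < x 2 < ⋯` of `[0,∞)`: on each interval `Δ_{k+1} = [x k, x (k+1)]` it is
absolutely continuous with derivative `f' ∈ L²`, encoded via the fundamental
theorem of calculus; `fr k = f(x k +)` and `fl (k+1) = f(x (k+1) −)` are the
one-sided limits at the nodes. -/
structure PW1 (x : ℕ → ℝ) where
  f : ℝ → ℝ
  f' : ℝ → ℝ
  fr : ℕ → ℝ
  fl : ℕ → ℝ
  int_d : ∀ k, IntegrableOn f' (Icc (x k) (x (k + 1))) volume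
  sq_d : ∀ k, IntegrableOn (fun t => f' t ^ 2) (Icc (x k) (x (k + 1))) volume
  ftc : ∀ k, ∀ t ∈ Ioo (x k) (x (k + 1)), f t = fr k + ∫ s in Ioc (x k) t, f' s
  fl_eq : ∀ k, fl (k + 1) = fr k + ∫ s in Ioc (x k) (x (k + 1)), f' s

/-- The jump `f(x_{k+1}+) − f(x_{k+1}−)` of a piecewise `H¹` function at the
interior node `x (k+1)` (the paper's node `x_{k+1}`). -/
def PW1.jump {x : ℕ → ℝ} (F : PW1 x) (k : ℕ) : ℝ := F.fr (k + 1) - F.fl (k + 1)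

/-- Membership in the domain of the form `t_{X,β,q}`: `f ∈ L²(0,∞)`,
`∫₀^∞ |f'|² < ∞`, `∫₀^∞ |q| |f|² < ∞` and `Σ_k |f(x_k+) − f(x_k−)|²/|β_k| < ∞`. -/
def MemDom (x : ℕ → ℝ) (q : ℝ → ℝ) (β : ℕ → ℝ) (F : PW1 x) : Prop :=
  IntegrableOn (fun t => F.f t ^ 2) (Ioi 0) volume ∧
  IntegrableOn (fun t => F.f' t ^ 2) (Ioi 0) volume ∧
  IntegrableOn (fun t => |q t| * F.f t ^ 2) (Ioi 0) volume ∧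
  Summable (fun k => F.jump k ^ 2 / |β (k + 1)|)

/-- The value of the quadratic form
`t_{X,β,q}[f] = ∫₀^∞ (|f'|² + q |f|²) dx + Σ_k |f(x_k+) − f(x_k−)|²/β_k`. -/
def formVal (x : ℕ → ℝ) (q : ℝ → ℝ) (β : ℕ → ℝ) (F : PW1 x) : ℝ :=
  (∫ t in Ioi (0 : ℝ), (F.f' t ^ 2 + q t * F.f t ^ 2)) +
    ∑' k, F.jump k ^ 2 / β (k + 1)


/-- Cauchy–Schwarz against the constant function `1`. -/
lemma sq_intervalIntegral_le {h : ℝ → ℝ} {s t : ℝ} (hst : s ≤ t)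
    (h1 : IntervalIntegrable h volume s t)
    (h2 : IntervalIntegrable (fun r => h r ^ 2) volume s t) :
    (∫ r in s..t, h r) ^ 2 ≤ (t - s) * ∫ r in s..t, h r ^ 2 := by
  rcases hst.eq_or_lt with rfl | hlt
  · simp
  set J := ∫ r in s..t, h r with hJ
  have hnn : 0 ≤ ∫ r in s..t, ((t - s) * h r - J) ^ 2 :=
    intervalIntegral.integral_nonneg hst fun r _ => sq_nonneg _
  have heq : (∫ r in s..t, ((t - s) * h r - J) ^ 2)
      = (t - s) * ((t - s) * (∫ r in s..t, h r ^ 2) - J ^ 2) := by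
    have hexp : (fun r => ((t - s) * h r - J) ^ 2)
        = fun r => ((t - s) ^ 2 * h r ^ 2 - 2 * (t - s) * J * h r) + J ^ 2 := by
      funext r; ring
    rw [hexp, intervalIntegral.integral_add ((h2.const_mul _).sub (h1.const_mul _))
        intervalIntegrable_const,
      intervalIntegral.integral_sub (h2.const_mul _) (h1.const_mul _),
      intervalIntegral.integral_const_mul, intervalIntegral.integral_const_mul,
      intervalIntegral.integral_const, ← hJ, smul_eq_mul]
    ring
  rw [heq] at hnn
  have := nonneg_of_mul_nonneg_right hnn (sub_pos.2 hlt)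
  linarith

/-- Oscillation bound for a primitive of a square integrable function. -/
lemma sq_intervalIntegral_le_of_mem {h : ℝ → ℝ} {a b s t : ℝ}
    (h1 : IntegrableOn h (Icc a b)) (h2 : IntegrableOn (fun r => h r ^ 2) (Icc a b))
    (hs : s ∈ Icc a b) (ht : t ∈ Icc a b) :
    (∫ r in s..t, h r) ^ 2 ≤ (b - a) * ∫ r in a..b, h r ^ 2 := by
  wlog hst : s ≤ t generalizing s t
  · rw [intervalIntegral.integral_symm, neg_sq]
    exact this ht hs (le_of_not_ge hst)
  have hab : a ≤ b := hs.1.trans hs.2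
  have hsub : uIcc s t ⊆ uIcc a b := by
    rw [uIcc_of_le hst, uIcc_of_le hab]; exact Icc_subset_Icc hs.1 ht.2
  have i1 : IntervalIntegrable h volume a b :=
    (intervalIntegrable_iff_integrableOn_Icc_of_le hab).2 h1
  have i2 : IntervalIntegrable (fun r => h r ^ 2) volume a b :=
    (intervalIntegrable_iff_integrableOn_Icc_of_le hab).2 h2
  refine (sq_intervalIntegral_le hst (i1.mono_set hsub) (i2.mono_set hsub)).trans ?_
  have hle : (∫ r in s..t, h r ^ 2) ≤ ∫ r in a..b, h r ^ 2 :=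
    intervalIntegral.integral_mono_interval hs.1 hst ht.2
      (Eventually.of_forall fun r => sq_nonneg _) i2
  have hnn : 0 ≤ ∫ r in s..t, h r ^ 2 :=
    intervalIntegral.integral_nonneg hst fun r _ => sq_nonneg _
  exact mul_le_mul (by linarith [hs.1, ht.2]) hle hnn (by linarith)

/-- The embedding `H¹(a, b) → L^∞(a, b)` with an explicit constant. -/
lemma length_mul_sq_primitive_le {h : ℝ → ℝ} {a b c t : ℝ}
    (h1 : IntegrableOn h (Icc a b)) (h2 : IntegrableOn (fun r => h r ^ 2) (Icc a b))
    (ht : t ∈ Icc a b) :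
    (b - a) * (c + ∫ r in a..t, h r) ^ 2 ≤ (2 + 2 * (b - a) ^ 2) *
      ∫ s in a..b, (h s ^ 2 + (c + ∫ r in a..s, h r) ^ 2) := by
  have hab : a ≤ b := ht.1.trans ht.2
  have i1 : IntervalIntegrable h volume a b :=
    (intervalIntegrable_iff_integrableOn_Icc_of_le hab).2 h1
  have i2 : IntervalIntegrable (fun r => h r ^ 2) volume a b :=
    (intervalIntegrable_iff_integrableOn_Icc_of_le hab).2 h2
  set g : ℝ → ℝ := fun s => c + ∫ r in a..s, h r with hg
  have gc : ContinuousOn g (uIcc a b) :=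
    continuousOn_const.add (intervalIntegral.continuousOn_primitive_interval
      (by rwa [uIcc_of_le hab]))
  have ig : IntervalIntegrable (fun s => g s ^ 2) volume a b :=
    (gc.pow 2).intervalIntegrable
  set A := ∫ r in a..b, h r ^ 2 with hA
  have hpt : ∀ s ∈ Icc a b, g t ^ 2 ≤ 2 * g s ^ 2 + 2 * ((b - a) * A) := by
    intro s hs
    have hosc := sq_intervalIntegral_le_of_mem h1 h2 hs ht
    have hsub : ∀ u ∈ Icc a b, IntervalIntegrable h volume a u := fun u hu =>
      i1.mono_set (by rw [uIcc_of_le hu.1, uIcc_of_le hab]; exact Icc_subset_Icc le_rfl hu.2)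
    have hdiff : g t - g s = ∫ r in s..t, h r := by
      rw [← intervalIntegral.integral_interval_sub_left (hsub t ht) (hsub s hs)]
      simp only [hg]; ring
    rw [← hdiff] at hosc
    nlinarith [sq_nonneg (g t - 2 * g s)]
  have hint := intervalIntegral.integral_mono_on hab
    (intervalIntegrable_const (c := g t ^ 2))
    ((ig.const_mul 2).add (intervalIntegrable_const (c := 2 * ((b - a) * A)))) hpt
  rw [intervalIntegral.integral_add (ig.const_mul 2) intervalIntegrable_const,
    intervalIntegral.integral_const_mul, intervalIntegral.integral_const,
    intervalIntegral.integral_const, smul_eq_mul, smul_eq_mul] at hint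
  have hA0 : 0 ≤ A := intervalIntegral.integral_nonneg hab fun r _ => sq_nonneg _
  have hB0 : 0 ≤ ∫ s in a..b, g s ^ 2 :=
    intervalIntegral.integral_nonneg hab fun r _ => sq_nonneg _
  rw [intervalIntegral.integral_add i2 ig, ← hA]
  change (b - a) * g t ^ 2 ≤ _
  nlinarith [mul_nonneg (sq_nonneg (b - a)) hB0]

namespace PW1

variable {x : ℕ → ℝ} (F : PW1 x)

/-- The squared `H¹` norm on the `k`-th cell. -/
def energy (k : ℕ) : ℝ := ∫ t in Ioo (x k) (x (k + 1)), (F.f' t ^ 2 + F.f t ^ 2)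

lemma energy_nonneg (k : ℕ) : 0 ≤ F.energy k :=
  integral_nonneg fun _ => by positivity

lemma eq_primitive {k : ℕ} {t : ℝ} (ht : t ∈ Ioo (x k) (x (k + 1))) :
    F.f t = F.fr k + ∫ r in x k..t, F.f' r := by
  rw [F.ftc k t ht, intervalIntegral.integral_of_le ht.1.le]

lemma energy_eq (hmono : StrictMono x) (k : ℕ) : F.energy k =
    ∫ t in x k..x (k + 1), (F.f' t ^ 2 + (F.fr k + ∫ r in x k..t, F.f' r) ^ 2) := by
  rw [intervalIntegral.integral_of_le (hmono k.lt_succ_self).le, integral_Ioc_eq_integral_Ioo]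
  exact setIntegral_congr_fun measurableSet_Ioo fun t ht => by
    simp only [F.eq_primitive ht]

lemma length_mul_sq_le (hmono : StrictMono x) {D : ℝ} {k : ℕ} (hD : x (k + 1) - x k ≤ D)
    {t : ℝ} (ht : t ∈ Ioo (x k) (x (k + 1))) :
    (x (k + 1) - x k) * F.f t ^ 2 ≤ (2 + 2 * D ^ 2) * F.energy k := by
  have hlen := sub_pos.2 (hmono k.lt_succ_self)
  have hb := length_mul_sq_primitive_le (c := F.fr k) (F.int_d k) (F.sq_d k)
    (Ioo_subset_Icc_self ht)
  rw [← F.energy_eq hmono, ← F.eq_primitive ht] at hb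
  refine hb.trans (mul_le_mul_of_nonneg_right ?_ (F.energy_nonneg k))
  gcongr

lemma continuousOn (k : ℕ) : ContinuousOn F.f (Ioo (x k) (x (k + 1))) :=
  (continuousOn_const.add ((intervalIntegral.continuousOn_primitive (F.int_d k)).mono
    Ioo_subset_Icc_self)).congr fun t ht => F.ftc k t ht

lemma integrableOn_mul_sq (hmono : StrictMono x) {q : ℝ → ℝ} {k : ℕ}
    (hq : IntegrableOn q (Icc (x k) (x (k + 1)))) :
    IntegrableOn (fun t => |q t| * F.f t ^ 2) (Ioo (x k) (x (k + 1))) := by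
  have hlen := sub_pos.2 (hmono k.lt_succ_self)
  refine Integrable.mul_bdd
    (c := (2 + 2 * (x (k + 1) - x k) ^ 2) * F.energy k / (x (k + 1) - x k))
    (hq.mono_set Ioo_subset_Icc_self).abs
    (((F.continuousOn k).pow 2).aestronglyMeasurable measurableSet_Ioo) ?_
  refine (ae_restrict_iff' measurableSet_Ioo).2 (Eventually.of_forall fun t ht => ?_)
  rw [Real.norm_of_nonneg (sq_nonneg _), le_div_iff₀ hlen, mul_comm]
  exact F.length_mul_sq_le hmono le_rfl ht

lemma setIntegral_mul_sq_le (hmono : StrictMono x) {q : ℝ → ℝ} {D : ℝ} {k : ℕ}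
    (hq : IntegrableOn q (Icc (x k) (x (k + 1)))) (hD : x (k + 1) - x k ≤ D) :
    ∫ t in Ioo (x k) (x (k + 1)), |q t| * F.f t ^ 2 ≤
      ((1 / (x (k + 1) - x k)) * ∫ t in Icc (x k) (x (k + 1)), |q t|) *
        ((2 + 2 * D ^ 2) * F.energy k) := by
  have hlen := sub_pos.2 (hmono k.lt_succ_self)
  calc ∫ t in Ioo (x k) (x (k + 1)), |q t| * F.f t ^ 2
      ≤ ∫ t in Ioo (x k) (x (k + 1)),
          |q t| * ((2 + 2 * D ^ 2) * F.energy k / (x (k + 1) - x k)) := by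
        refine setIntegral_mono_on (F.integrableOn_mul_sq hmono hq)
          ((hq.mono_set Ioo_subset_Icc_self).abs.mul_const _) measurableSet_Ioo fun t ht => ?_
        refine mul_le_mul_of_nonneg_left ?_ (abs_nonneg _)
        rw [le_div_iff₀ hlen, mul_comm]
        exact F.length_mul_sq_le hmono hD ht
    _ = _ := by
        rw [integral_mul_const, integral_Icc_eq_integral_Ioo]
        ring

end PW1

/-- **Core of Lemma 4.2** (compactness of the embedding
`W^{1,2}(ℝ₊∖X) → L²(ℝ₊; |q|)`): if `d^* < ∞` and `(1/d_k) ∫_Δₖ |q| → 0`, then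
the tails `∫_{x_N}^∞ |q| |f|²` are uniformly small over the unit ball. -/
theorem stmt_17 (x : ℕ → ℝ) (hx0 : x 0 = 0) (hmono : StrictMono x)
    (hxtop : Tendsto x atTop atTop)
    (q : ℝ → ℝ) (hq : ∀ a b : ℝ, 0 ≤ a → IntegrableOn q (Icc a b) volume)
    (D : ℝ) (hD : ∀ k, x (k + 1) - x k ≤ D)
    (hq0 : Tendsto (fun k =>
      (1 / (x (k + 1) - x k)) * ∫ t in Icc (x k) (x (k + 1)), |q t|)
      atTop (nhds 0)) :
    ∀ ε > 0, ∃ N : ℕ, ∀ F : PW1 x,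
      Summable (fun k => ∫ t in Ioo (x k) (x (k + 1)), (F.f' t ^ 2 + F.f t ^ 2)) →
      (∑' k, ∫ t in Ioo (x k) (x (k + 1)), (F.f' t ^ 2 + F.f t ^ 2)) ≤ 1 →
      (IntegrableOn (fun t => |q t| * F.f t ^ 2) (Ioi (x N)) volume ∧
        (∫ t in Ioi (x N), |q t| * F.f t ^ 2) ≤ ε) := by
  intro ε hε
  have hC : 0 < 2 + 2 * D ^ 2 := by positivity
  obtain ⟨N, hN⟩ := eventually_atTop.1 (hq0.eventually (ge_mem_nhds (div_pos hε hC)))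
  refine ⟨N, fun F hsum hle => ?_⟩
  change Summable F.energy at hsum
  change ∑' k, F.energy k ≤ 1 at hle
  have hx : ∀ k, 0 ≤ x k := fun k => hx0 ▸ hmono.monotone k.zero_le
  have hqk : ∀ k, IntegrableOn q (Icc (x k) (x (k + 1))) := fun k => hq _ _ (hx k)
  set w : ℝ → ℝ := fun t => |q t| * F.f t ^ 2 with hw
  have hw0 : ∀ t, 0 ≤ w t := fun t => by positivity
  have hii : ∀ k, IntervalIntegrable w volume (x k) (x (k + 1)) := fun k =>
    (intervalIntegrable_iff_integrableOn_Ioo_of_le (hmono k.lt_succ_self).le).2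
      (F.integrableOn_mul_sq hmono (hqk k))
  have hcell : ∀ k, N ≤ k → ∫ t in x k..x (k + 1), w t ≤ ε * F.energy k := by
    intro k hk
    rw [intervalIntegral.integral_of_le (hmono k.lt_succ_self).le, integral_Ioc_eq_integral_Ioo]
    refine (F.setIntegral_mul_sq_le hmono (hqk k) (hD k)).trans ?_
    refine (mul_le_mul_of_nonneg_right (hN k hk)
      (mul_nonneg hC.le (F.energy_nonneg k))).trans_eq ?_
    field_simp
  have hpartial : ∀ n, N ≤ n → ∫ t in x N..x n, w t ≤ ε := by
    intro n hn
    rw [← intervalIntegral.sum_integral_adjacent_intervals_Ico hn fun k _ => hii k]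
    calc ∑ k ∈ Finset.Ico N n, ∫ t in x k..x (k + 1), w t
        ≤ ∑ k ∈ Finset.Ico N n, ε * F.energy k :=
          Finset.sum_le_sum fun k hk => hcell k (Finset.mem_Ico.1 hk).1
      _ = ε * ∑ k ∈ Finset.Ico N n, F.energy k := (Finset.mul_sum _ _ _).symm
      _ ≤ ε * 1 := by
          gcongr
          exact (hsum.sum_le_tsum _ fun k _ => F.energy_nonneg k).trans hle
      _ = ε := mul_one ε
  have hint : IntegrableOn w (Ioi (x N)) := by
    refine integrableOn_Ioi_of_intervalIntegral_norm_bounded ε (x N) (fun n => ?_) hxtop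
      (eventually_atTop.2 ⟨N, fun n hn => ?_⟩)
    · rcases le_total N n with hn | hn
      · exact (intervalIntegrable_iff_integrableOn_Ioc_of_le (hmono.monotone hn)).1
          (IntervalIntegrable.trans_iterate_Ico hn fun k _ => hii k)
      · simp [Ioc_eq_empty_of_le (hmono.monotone hn)]
    · simpa only [Real.norm_of_nonneg (hw0 _)] using hpartial n hn
  exact ⟨hint, le_of_tendsto (intervalIntegral_tendsto_integral_Ioi (x N) hint hxtop)
    (eventually_atTop.2 ⟨N, hpartial⟩)⟩

end
end
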